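/- Let A ∈ ℝ^{n×n}, C ∈ ℝ^{m×n}, N ≥ 1 with W := [Cᵀ, AᵀCᵀ, …, A^{(N−1)T}Cᵀ]ᵀ of full column rank n, and R ∈ ℝ^{m×m} symmetric positive definite. Define Q := Σ_{i=0}^{N−2} A^{iT} Cᵀ R C A^i and H := A^{(N−1)T} Cᵀ R C A^{N−1}. Let z, x̃ ∈ ℝ^n, y := C A^{N−1} x̃, η := (Q+H)^{−1} A^{(N−1)T} Cᵀ R y + (Q+H)^{−1} Q z, z⁺ := A η, and x̃⁺ := A x̃. Then (z⁺ − x̃⁺)ᵀ Q (z⁺ − x̃⁺) ≤ (z − x̃)ᵀ Q (z − x̃) − J(η, z, y), where J(ξ, z, y) := ‖C A^{N−1} ξ − y‖²_R + Σ_{i=0}^{N−2} ‖C A^i ξ − C A^i z‖²_R. -/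

import Mathlib

open Matrix Filter Finset

/-- `‖v‖²_R = vᵀ R v`. -/
noncomputable def quadForm {m : ℕ} (R : Matrix (Fin m) (Fin m) ℝ) (v : Fin m → ℝ) : ℝ :=
  v ⬝ᵥ R.mulVec v

/-- The cost `J(ξ, z, y) = ‖C A^{N-1} ξ - y‖²_R + Σ_{i=0}^{N-2} ‖C A^i ξ - C A^i z‖²_R`. -/
noncomputable def Jcost {n m : ℕ} (A : Matrix (Fin n) (Fin n) ℝ) (C : Matrix (Fin m) (Fin n) ℝ)
    (R : Matrix (Fin m) (Fin m) ℝ) (N : ℕ) (ξ z : Fin n → ℝ) (y : Fin m → ℝ) : ℝ :=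
  quadForm R ((C * A ^ (N - 1)).mulVec ξ - y) +
    ∑ i ∈ Finset.range (N - 1), quadForm R ((C * A ^ i).mulVec ξ - (C * A ^ i).mulVec z)

/-- `Q := Σ_{i=0}^{N-2} A^{iT} Cᵀ R C A^i`. -/
noncomputable def Qmat {n m : ℕ} (A : Matrix (Fin n) (Fin n) ℝ) (C : Matrix (Fin m) (Fin n) ℝ)
    (R : Matrix (Fin m) (Fin m) ℝ) (N : ℕ) : Matrix (Fin n) (Fin n) ℝ :=
  ∑ i ∈ Finset.range (N - 1), (A ^ i)ᵀ * Cᵀ * R * C * A ^ i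

/-- `H := A^{(N-1)T} Cᵀ R C A^{N-1}`. -/
noncomputable def Hmat {n m : ℕ} (A : Matrix (Fin n) (Fin n) ℝ) (C : Matrix (Fin m) (Fin n) ℝ)
    (R : Matrix (Fin m) (Fin m) ℝ) (N : ℕ) : Matrix (Fin n) (Fin n) ℝ :=
  (A ^ (N - 1))ᵀ * Cᵀ * R * C * A ^ (N - 1)

theorem dotProduct_gram_mulVec {n m : ℕ} (B : Matrix (Fin n) (Fin n) ℝ)
    (C : Matrix (Fin m) (Fin n) ℝ) (R : Matrix (Fin m) (Fin m) ℝ) (u v : Fin n → ℝ) :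
    u ⬝ᵥ (Bᵀ * Cᵀ * R * C * B) *ᵥ v = ((C * B) *ᵥ u) ⬝ᵥ R *ᵥ ((C * B) *ᵥ v) := by
  rw [show Bᵀ * Cᵀ * R * C * B = (C * B)ᵀ * (R * (C * B)) by
    simp only [Matrix.transpose_mul, Matrix.mul_assoc]]
  rw [← Matrix.mulVec_mulVec v (C * B)ᵀ, Matrix.dotProduct_mulVec, Matrix.vecMul_transpose,
    ← Matrix.mulVec_mulVec v R]

theorem dotProduct_Qmat_mulVec_self {n m : ℕ} (A : Matrix (Fin n) (Fin n) ℝ)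
    (C : Matrix (Fin m) (Fin n) ℝ) (R : Matrix (Fin m) (Fin m) ℝ) (N : ℕ) (u : Fin n → ℝ) :
    u ⬝ᵥ Qmat A C R N *ᵥ u = ∑ i ∈ Finset.range (N - 1), quadForm R ((C * A ^ i) *ᵥ u) := by
  simp only [Qmat, Matrix.sum_mulVec, dotProduct_sum, dotProduct_gram_mulVec, quadForm]

theorem dotProduct_Hmat_mulVec_self {n m : ℕ} (A : Matrix (Fin n) (Fin n) ℝ)
    (C : Matrix (Fin m) (Fin n) ℝ) (R : Matrix (Fin m) (Fin m) ℝ) (N : ℕ) (u : Fin n → ℝ) :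
    u ⬝ᵥ Hmat A C R N *ᵥ u = quadForm R ((C * A ^ (N - 1)) *ᵥ u) :=
  dotProduct_gram_mulVec _ C R u u

theorem dotProduct_Qmat_add_Hmat_mulVec_self {n m : ℕ} (A : Matrix (Fin n) (Fin n) ℝ)
    (C : Matrix (Fin m) (Fin n) ℝ) (R : Matrix (Fin m) (Fin m) ℝ) {N : ℕ} (hN : 1 ≤ N)
    (u : Fin n → ℝ) :
    u ⬝ᵥ (Qmat A C R N + Hmat A C R N) *ᵥ u =
      ∑ i ∈ Finset.range N, quadForm R ((C * A ^ i) *ᵥ u) := by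
  obtain ⟨k, rfl⟩ := Nat.exists_eq_add_of_le' hN
  rw [Matrix.add_mulVec, dotProduct_add, dotProduct_Qmat_mulVec_self,
    dotProduct_Hmat_mulVec_self, Finset.sum_range_succ, Nat.add_sub_cancel]

theorem Qmat_transpose {n m : ℕ} (A : Matrix (Fin n) (Fin n) ℝ)
    (C : Matrix (Fin m) (Fin n) ℝ) {R : Matrix (Fin m) (Fin m) ℝ} (hR : Rᵀ = R) (N : ℕ) :
    (Qmat A C R N)ᵀ = Qmat A C R N := by
  simp only [Qmat, Matrix.transpose_sum, Matrix.transpose_mul, Matrix.transpose_transpose, hR,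
    Matrix.mul_assoc]

theorem quadForm_nonneg {m : ℕ} {R : Matrix (Fin m) (Fin m) ℝ} (hR : R.PosDef)
    (v : Fin m → ℝ) : 0 ≤ quadForm R v := by
  simpa [quadForm] using hR.posSemidef.dotProduct_mulVec_nonneg v

theorem eq_zero_of_quadForm_eq_zero {m : ℕ} {R : Matrix (Fin m) (Fin m) ℝ} (hR : R.PosDef)
    {v : Fin m → ℝ} (hv : quadForm R v = 0) : v = 0 := by
  by_contra h
  have hpos : 0 < quadForm R v := by simpa [quadForm] using hR.dotProduct_mulVec_pos h
  exact hpos.ne' hv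

theorem mulVec_injective_of_rank_eq {ι : Type*} [Fintype ι] {n : ℕ}
    {W : Matrix ι (Fin n) ℝ} (hW : W.rank = n) : Function.Injective W.mulVec := by
  have h := W.mulVecLin.finrank_range_add_finrank_ker
  rw [Module.finrank_fin_fun, ← Matrix.rank, hW] at h
  have hker : Module.finrank ℝ (LinearMap.ker W.mulVecLin) = 0 := by omega
  exact LinearMap.ker_eq_bot.mp (Submodule.finrank_eq_zero.mp hker)

theorem isUnit_Qmat_add_Hmat {n m : ℕ} (A : Matrix (Fin n) (Fin n) ℝ)
    (C : Matrix (Fin m) (Fin n) ℝ) {N : ℕ} (hN : 1 ≤ N)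
    (hW : (Matrix.of fun (p : Fin N × Fin m) (j : Fin n) =>
      (C * A ^ (p.1 : ℕ)) p.2 j).rank = n)
    {R : Matrix (Fin m) (Fin m) ℝ} (hR : R.PosDef) :
    IsUnit (Qmat A C R N + Hmat A C R N) := by
  rw [← Matrix.mulVec_injective_iff_isUnit]
  refine (injective_iff_map_eq_zero (Matrix.mulVecLin (Qmat A C R N + Hmat A C R N))).mpr
    fun x hx => mulVec_injective_of_rank_eq hW ?_
  have hsum := dotProduct_Qmat_add_Hmat_mulVec_self A C R hN x
  rw [← Matrix.mulVecLin_apply, hx, dotProduct_zero, eq_comm,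
    Finset.sum_eq_zero_iff_of_nonneg fun i _ => quadForm_nonneg hR _] at hsum
  rw [Matrix.mulVec_zero]
  ext p
  exact congrFun (eq_zero_of_quadForm_eq_zero hR (hsum p.1 (Finset.mem_range.mpr p.1.2))) p.2

theorem dotProduct_Qmat_mulVec_mulVec_le {n m : ℕ} (A : Matrix (Fin n) (Fin n) ℝ)
    (C : Matrix (Fin m) (Fin n) ℝ) {R : Matrix (Fin m) (Fin m) ℝ} (hR : R.PosDef)
    {N : ℕ} (hN : 1 ≤ N) (u : Fin n → ℝ) :
    (A *ᵥ u) ⬝ᵥ Qmat A C R N *ᵥ (A *ᵥ u) ≤ u ⬝ᵥ (Qmat A C R N + Hmat A C R N) *ᵥ u := by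
  rw [dotProduct_Qmat_add_Hmat_mulVec_self A C R hN, dotProduct_Qmat_mulVec_self]
  obtain ⟨k, rfl⟩ := Nat.exists_eq_add_of_le' hN
  rw [Finset.sum_range_succ', Nat.add_sub_cancel]
  simp only [Matrix.mulVec_mulVec, Matrix.mul_assoc, ← pow_succ]
  exact le_add_of_nonneg_right (quadForm_nonneg hR _)

/-- **The Lyapunov-type inequality (eqn. `eqn:lyap`).**
With `y = C A^{N-1} x̃`, `η` the optimal estimate, `z⁺ = A η` and `x̃⁺ = A x̃`,
`(z⁺ - x̃⁺)ᵀ Q (z⁺ - x̃⁺) ≤ (z - x̃)ᵀ Q (z - x̃) - J(η, z, y)`. -/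
theorem stmt_5 {n m : ℕ} (A : Matrix (Fin n) (Fin n) ℝ) (C : Matrix (Fin m) (Fin n) ℝ)
    (N : ℕ) (hN : 1 ≤ N)
    (hW : (Matrix.of fun (p : Fin N × Fin m) (j : Fin n) =>
      (C * A ^ (p.1 : ℕ)) p.2 j).rank = n)
    (R : Matrix (Fin m) (Fin m) ℝ) (hR : R.PosDef)
    (z xt : Fin n → ℝ) (y : Fin m → ℝ) (hy : y = (C * A ^ (N - 1)).mulVec xt)
    (η : Fin n → ℝ)
    (hη : η = ((Qmat A C R N + Hmat A C R N)⁻¹ * (A ^ (N - 1))ᵀ * Cᵀ * R).mulVec y +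
        ((Qmat A C R N + Hmat A C R N)⁻¹ * Qmat A C R N).mulVec z)
    (zplus xtplus : Fin n → ℝ)
    (hzplus : zplus = A.mulVec η) (hxtplus : xtplus = A.mulVec xt) :
    (zplus - xtplus) ⬝ᵥ (Qmat A C R N).mulVec (zplus - xtplus) ≤
      (z - xt) ⬝ᵥ (Qmat A C R N).mulVec (z - xt) - Jcost A C R N η z y := by
  have hsymm : Rᵀ = R := by simpa using hR.isHermitian.eq
  have hJ : Jcost A C R N η z y = (η - xt) ⬝ᵥ Hmat A C R N *ᵥ (η - xt) +
      (η - z) ⬝ᵥ Qmat A C R N *ᵥ (η - z) := by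
    simp only [Jcost, hy, ← Matrix.mulVec_sub, dotProduct_Qmat_mulVec_self,
      dotProduct_Hmat_mulVec_self]
  have hnormal : (Qmat A C R N + Hmat A C R N) *ᵥ (η - xt) = Qmat A C R N *ᵥ (z - xt) := by
    have hdet := (Matrix.isUnit_iff_isUnit_det _).mp (isUnit_Qmat_add_Hmat A C hN hW hR)
    have hη' : (Qmat A C R N + Hmat A C R N) *ᵥ η =
        Hmat A C R N *ᵥ xt + Qmat A C R N *ᵥ z := by
      rw [hη, hy, Matrix.mulVec_add]
      simp only [Matrix.mulVec_mulVec, Matrix.mul_assoc,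
        Matrix.mul_nonsing_inv_cancel_left _ _ hdet]
      simp only [Hmat, Matrix.mul_assoc]
    rw [Matrix.mulVec_sub, hη', Matrix.add_mulVec, Matrix.mulVec_sub]
    abel
  rw [hzplus, hxtplus, ← Matrix.mulVec_sub, hJ, show η - z = (η - xt) - (z - xt) by abel]
  generalize η - xt = e at *
  generalize z - xt = d at *
  have hle := dotProduct_Qmat_mulVec_mulVec_le A C hR hN e
  have hcross : d ⬝ᵥ Qmat A C R N *ᵥ e = e ⬝ᵥ Qmat A C R N *ᵥ d := by
    rw [Matrix.dotProduct_mulVec, ← Matrix.mulVec_transpose, Qmat_transpose A C hsymm,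
      dotProduct_comm]
  have hnormal' := congrArg (e ⬝ᵥ ·) hnormal
  simp only [Matrix.add_mulVec, dotProduct_add] at hle hnormal'
  simp only [Matrix.mulVec_sub, dotProduct_sub, sub_dotProduct, hcross]
  linarith
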